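/- Let k be a perfect field of characteristic p > 0 and let A = k ⊗_{F_p} k be the tensor product of k with itself over the prime field, viewed as a commutative k-algebra. Regard k as an A-module via the multiplication map A → k, λ ⊗ μ ↦ λμ. Then Tor_n^A(k, k) = 0 for every n ≥ 1. -/

import Mathlib

/-! STATEMENT 7: for a perfect field `k` of characteristic `p > 0`, and `A = k ⊗_{F_p} k`,
the `A`-module `k` (via the multiplication map `A → k`) satisfies `Tor_n^A(k, k) = 0` for all
`n ≥ 1` (vanishing of the Hochschild homology of `k` in positive degrees). -/

universe u

open CategoryTheory Abelian Limits
open scoped TensorProduct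

namespace DjamentTouze

section ProjectiveModules

variable {A : Type*} [CommRing A] {M : Type*} [AddCommGroup M] [Module A M] [Module.Projective A M]

lemma mem_ideal_smul_top_iff (I : Ideal A) (x : M) :
    x ∈ I • (⊤ : Submodule A M) ↔ ∀ φ : Module.Dual A M, φ x ∈ I := by
  constructor
  · intro hx φ
    exact Submodule.smul_induction_on hx
      (fun a ha y _ => by rw [map_smul]; exact I.mul_mem_right _ ha)
      (fun y z hy hz => by rw [map_add]; exact I.add_mem hy hz)
  · intro h
    obtain ⟨s, hs⟩ := Module.projective_def.1 ‹Module.Projective A M›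
    rw [← hs x, Finsupp.linearCombination_apply]
    exact Submodule.sum_mem _ fun i _ =>
      Submodule.smul_mem_smul (h (Finsupp.lapply i ∘ₗ s)) Submodule.mem_top

lemma mem_inf_smul_top {I J : Ideal A} {x : M} (hI : x ∈ I • (⊤ : Submodule A M))
    (hJ : x ∈ J • (⊤ : Submodule A M)) : x ∈ (I ⊓ J) • (⊤ : Submodule A M) := by
  rw [mem_ideal_smul_top_iff] at hI hJ ⊢
  exact fun φ => ⟨hI φ, hJ φ⟩

lemma smul_eq_zero_of_annihilator_le {a b : A} (h : ∀ c : A, a * c = 0 → b * c = 0) {x : M}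
    (hx : a • x = 0) : b • x = 0 := by
  have : b • x ∈ (⊥ : Ideal A) • (⊤ : Submodule A M) := by
    refine (mem_ideal_smul_top_iff _ _).2 fun φ => ?_
    rw [map_smul, smul_eq_mul]
    exact h _ (by rw [← smul_eq_mul, ← map_smul, hx, map_zero])
  simpa using this

end ProjectiveModules

section PerfectRings

variable {A : Type*} [CommRing A]

lemma radical_sup_of_perfectRing (p : ℕ) [Fact p.Prime] [CharP A p] [PerfectRing A p]
    (I J : Ideal A) :
    (I ⊔ J).radical = I.radical ⊔ J.radical := by
  refine le_antisymm (fun x hx => ?_)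
    (sup_le (Ideal.radical_mono le_sup_left) (Ideal.radical_mono le_sup_right))
  obtain ⟨n, hn⟩ := hx
  have hp : x ^ p ^ n ∈ I ⊔ J :=
    Ideal.pow_mem_of_pow_mem _ hn (Nat.lt_pow_self (Fact.out : p.Prime).one_lt).le
  obtain ⟨a, ha, b, hb, hab⟩ := Submodule.mem_sup.1 hp
  obtain ⟨a, rfl⟩ := (iterateFrobeniusEquiv A p n).surjective a
  obtain ⟨b, rfl⟩ := (iterateFrobeniusEquiv A p n).surjective b
  rw [← map_add, ← iterateFrobeniusEquiv_def A p n x] at hab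
  rw [← (iterateFrobeniusEquiv A p n).injective hab]
  exact Submodule.add_mem_sup ⟨p ^ n, ha⟩ ⟨p ^ n, hb⟩

/-- Elements of `√(f) M` are multiples of some `p ^ m`-th root of `f`. -/
lemma exists_root_smul_eq (p : ℕ) [Fact p.Prime] [CharP A p] [PerfectRing A p]
    {M : Type*} [AddCommGroup M] [Module A M] (f : A) {x : M}
    (hx : x ∈ (Ideal.span {f}).radical • (⊤ : Submodule A M)) :
    ∃ (m : ℕ) (g : A) (y : M), g ^ p ^ m = f ∧ g • y = x := by
  induction hx using Submodule.smul_induction_on' with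
  | smul a ha y _ =>
    obtain ⟨n, hn⟩ := ha
    have hp : a ^ p ^ n ∈ Ideal.span {f} :=
      Ideal.pow_mem_of_pow_mem _ hn (Nat.lt_pow_self (Fact.out : p.Prime).one_lt).le
    obtain ⟨c, hc⟩ := Ideal.mem_span_singleton.1 hp
    obtain ⟨g, rfl⟩ := (iterateFrobeniusEquiv A p n).surjective f
    obtain ⟨c, rfl⟩ := (iterateFrobeniusEquiv A p n).surjective c
    rw [← map_mul, ← iterateFrobeniusEquiv_def A p n a] at hc
    rw [(iterateFrobeniusEquiv A p n).injective hc]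
    exact ⟨n, g, c • y, rfl, smul_smul _ _ _⟩
  | add x _ y _ hx hy =>
    obtain ⟨m, g, u, hg, rfl⟩ := hx
    obtain ⟨l, h, v, hh, rfl⟩ := hy
    obtain ⟨r, hr⟩ := (iterateFrobeniusEquiv A p (m + l)).surjective f
    rw [iterateFrobeniusEquiv_def] at hr
    have hgr : r ^ p ^ l = g := by
      apply (iterateFrobeniusEquiv A p m).injective
      rw [iterateFrobeniusEquiv_def, iterateFrobeniusEquiv_def, hg, ← hr]
      ring
    have hhr : r ^ p ^ m = h := by
      apply (iterateFrobeniusEquiv A p l).injective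
      rw [iterateFrobeniusEquiv_def, iterateFrobeniusEquiv_def, hh, ← hr]
      ring
    have hpos (i : ℕ) : p ^ i - 1 + 1 = p ^ i :=
      Nat.sub_add_cancel (Nat.one_le_pow _ _ (Fact.out : p.Prime).pos)
    refine ⟨m + l, r, r ^ (p ^ l - 1) • u + r ^ (p ^ m - 1) • v, hr, ?_⟩
    rw [smul_add, smul_smul, smul_smul, ← pow_succ', ← pow_succ', hpos, hpos, hgr, hhr]

end PerfectRings

section Complexes

variable {A : Type*} [CommRing A] {P : ℕ → Type*} [∀ n, AddCommGroup (P n)] [∀ n, Module A (P n)]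
  (d : ∀ n, P (n + 1) →ₗ[A] P n)

/-- The cycles of a sequence `⋯ → P 2 → P 1 → P 0`; every element of degree `0` is a cycle. -/
def chainCycles : ∀ n, Submodule A (P n)
  | 0 => ⊤
  | n + 1 => (d n).ker

/-- The subsequence `I P` is exact in every degree, including degree `0`. -/
def IsAcyclicAlong (I : Ideal A) : Prop :=
  ∀ n, ∀ x ∈ I • (⊤ : Submodule A (P n)), x ∈ chainCycles d n →
    ∃ z ∈ I • (⊤ : Submodule A (P (n + 1))), d n z = x

variable {d}

lemma map_mem_smul_top {M N : Type*} [AddCommGroup M] [AddCommGroup N] [Module A M] [Module A N]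
    (f : M →ₗ[A] N) {I : Ideal A} {x : M} (hx : x ∈ I • (⊤ : Submodule A M)) :
    f x ∈ I • (⊤ : Submodule A N) :=
  Submodule.smul_top_le_comap_smul_top I f hx

lemma IsAcyclicAlong.sup [∀ n, Module.Projective A (P n)] (hd : ∀ n x, d n (d (n + 1) x) = 0)
    {I J : Ideal A} (hI : IsAcyclicAlong d I) (hJ : IsAcyclicAlong d J)
    (hIJ : IsAcyclicAlong d (I ⊓ J)) : IsAcyclicAlong d (I ⊔ J) := by
  intro n x hx hxc
  rw [Submodule.sup_smul] at hx ⊢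
  obtain ⟨a, ha, b, hb, rfl⟩ := Submodule.mem_sup.1 hx
  cases n with
  | zero =>
    obtain ⟨y, hy, rfl⟩ := hI 0 a ha trivial
    obtain ⟨z, hz, rfl⟩ := hJ 0 b hb trivial
    exact ⟨y + z, Submodule.add_mem_sup hy hz, map_add _ _ _⟩
  | succ n =>
    have hab : d n a = d n (-b) := by
      rw [map_neg]
      exact eq_neg_of_add_eq_zero_left ((map_add _ _ _).symm.trans hxc)
    have hmem : d n a ∈ (I ⊓ J) • (⊤ : Submodule A (P n)) :=
      mem_inf_smul_top (map_mem_smul_top _ ha)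
        (hab ▸ map_mem_smul_top _ (Submodule.neg_mem _ hb))
    have hcyc : d n a ∈ chainCycles d n := by
      cases n with
      | zero => trivial
      | succ n => exact hd n a
    obtain ⟨w, hw, hwa⟩ := hIJ n _ hmem hcyc
    obtain ⟨y, hy, hya⟩ := hI (n + 1) (a - w)
      (Submodule.sub_mem _ ha (Submodule.smul_mono_left inf_le_left hw))
      (LinearMap.mem_ker.2 (by rw [map_sub, hwa, sub_self]))
    obtain ⟨z, hz, hzb⟩ := hJ (n + 1) (b + w)
      (Submodule.add_mem _ hb (Submodule.smul_mono_left inf_le_right hw))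
      (LinearMap.mem_ker.2 (by rw [map_add, hwa, hab, map_neg, add_neg_cancel]))
    exact ⟨y + z, Submodule.add_mem_sup hy hz, by rw [map_add, hya, hzb]; abel⟩

variable [∀ n, Module.Projective A (P n)]

lemma isAcyclicAlong_radical_span_singleton (p : ℕ) [Fact p.Prime] [CharP A p] [PerfectRing A p]
    {I : Ideal A} (hI : I.IsRadical)
    (hexact : ∀ n, (d n).ker ≤ (d (n + 1)).range)
    (hzero : I • (⊤ : Submodule A (P 0)) ≤ (d 0).range) {f : A} (hf : f ∈ I) :
    IsAcyclicAlong d (Ideal.span {f}).radical := by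
  intro n x hx hxc
  obtain ⟨m, g, y, hg, rfl⟩ := exists_root_smul_eq p f hx
  have hp : 1 < p := (Fact.out : p.Prime).one_lt
  obtain ⟨h, rfl⟩ := (frobeniusEquiv A p).surjective g
  rw [frobeniusEquiv_def] at *
  have hmem : h ∈ (Ideal.span {f}).radical :=
    ⟨p * p ^ m, by rw [pow_mul, hg]; exact Ideal.mem_span_singleton_self f⟩
  have hle : (Ideal.span {f}).radical ≤ I :=
    hI.radical_le_iff.2 ((Ideal.span_singleton_le_iff_mem _).2 hf)
  have hann (c : A) (hc : h ^ p * c = 0) : h * c = 0 := by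
    apply injective_pow_p A p
    rw [zero_pow (by lia), mul_pow, ← Nat.sub_add_cancel hp.le, pow_succ c, mul_left_comm,
      Nat.sub_add_cancel hp.le, hc, mul_zero]
  have hy : h • y ∈ (d n).range := by
    cases n with
    | zero => exact hzero (Submodule.smul_mem_smul (hle hmem) trivial)
    | succ n =>
      refine hexact n (LinearMap.mem_ker.2 ?_)
      rw [map_smul]
      exact smul_eq_zero_of_annihilator_le hann (by rw [← map_smul]; exact hxc)
  obtain ⟨z, hz⟩ := hy
  refine ⟨h ^ (p - 1) • z, Submodule.smul_mem_smul (Ideal.pow_mem_of_mem _ hmem _ (by lia))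
    trivial, ?_⟩
  rw [map_smul, hz, smul_smul, ← pow_succ, Nat.sub_add_cancel hp.le]

lemma span_singleton_mul_ofList (f : A) (l : List A) :
    Ideal.span {f} * Ideal.ofList l = Ideal.ofList (l.map (f * ·)) := by
  induction l with
  | nil => simp
  | cons a l ih =>
    rw [List.map_cons, Ideal.ofList_cons, Ideal.ofList_cons, Ideal.mul_sup, ih,
      Ideal.span_singleton_mul_span_singleton]

lemma isAcyclicAlong_radical_ofList (p : ℕ) [Fact p.Prime] [CharP A p] [PerfectRing A p]
    (hd : ∀ n x, d n (d (n + 1) x) = 0) {I : Ideal A}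
    (hI : ∀ f ∈ I, IsAcyclicAlong d (Ideal.span {f}).radical) (r : ℕ) :
    ∀ l : List A, l.length = r → (∀ f ∈ l, f ∈ I) →
      IsAcyclicAlong d (Ideal.ofList l).radical := by
  induction r with
  | zero =>
    intro l hl _
    rw [List.length_eq_zero_iff.1 hl]
    simpa using hI 0 I.zero_mem
  | succ r ih =>
    rintro (_ | ⟨f, l⟩) hl hlI
    · simp at hl
    · have hl' : l.length = r := by simpa using hl
      have hlI' : ∀ g ∈ l, g ∈ I := fun g hg => hlI g (List.mem_cons_of_mem _ hg)
      rw [Ideal.ofList_cons, radical_sup_of_perfectRing p]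
      refine (hI f (hlI f List.mem_cons_self)).sup hd (ih l hl' hlI') ?_
      rw [← Ideal.radical_mul, span_singleton_mul_ofList]
      refine ih _ (by simpa using hl') fun g hg => ?_
      obtain ⟨a, ha, rfl⟩ := List.mem_map.1 hg
      exact I.mul_mem_left _ (hlI' a ha)

lemma exists_ofList_smul {M : Type*} [AddCommGroup M] [Module A M] {I : Ideal A} {x : M}
    (hx : x ∈ I • (⊤ : Submodule A M)) :
    ∃ l : List A, (∀ f ∈ l, f ∈ I) ∧ x ∈ Ideal.ofList l • (⊤ : Submodule A M) := by
  induction hx using Submodule.smul_induction_on' with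
  | smul a ha y _ =>
    exact ⟨[a], by simpa using ha,
      Submodule.smul_mem_smul (by simp) trivial⟩
  | add x _ y _ hx hy =>
    obtain ⟨l, hl, hx⟩ := hx
    obtain ⟨l', hl', hy⟩ := hy
    refine ⟨l ++ l', fun f hf => (List.mem_append.1 hf).elim (hl f) (hl' f), ?_⟩
    rw [Ideal.ofList_append, Submodule.sup_smul]
    exact Submodule.add_mem_sup hx hy

/-- Let `P` be a projective resolution of a module annihilated by a radical ideal `I` of a perfect
ring. Then `I P` is acyclic. -/
lemma isAcyclicAlong_of_isRadical (p : ℕ) [Fact p.Prime] [CharP A p] [PerfectRing A p]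
    (hd : ∀ n x, d n (d (n + 1) x) = 0) {I : Ideal A}
    (hI : I.IsRadical) (hexact : ∀ n, (d n).ker ≤ (d (n + 1)).range)
    (hzero : I • (⊤ : Submodule A (P 0)) ≤ (d 0).range) : IsAcyclicAlong d I := by
  intro n x hx hxc
  obtain ⟨l, hl, hxl⟩ := exists_ofList_smul hx
  obtain ⟨z, hz, rfl⟩ := isAcyclicAlong_radical_ofList p hd
    (fun f hf => isAcyclicAlong_radical_span_singleton p hI hexact hzero hf) _ l rfl hl n x
    (Submodule.smul_mono_left Ideal.le_radical hxl) hxc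
  exact ⟨z, Submodule.smul_mono_left (hI.radical_le_iff.2 (Ideal.span_le.2 hl)) hz, rfl⟩

/-- Reduction modulo `I` preserves exactness in positive degrees. -/
lemma exists_sub_mem_smul_top (p : ℕ) [Fact p.Prime] [CharP A p] [PerfectRing A p]
    (hd : ∀ n x, d n (d (n + 1) x) = 0) {I : Ideal A}
    (hI : I.IsRadical) (hexact : ∀ n, (d n).ker ≤ (d (n + 1)).range)
    (hzero : I • (⊤ : Submodule A (P 0)) ≤ (d 0).range) (n : ℕ) (y : P (n + 1))
    (hy : d n y ∈ I • (⊤ : Submodule A (P n))) :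
    ∃ z, y - d (n + 1) z ∈ I • (⊤ : Submodule A (P (n + 1))) := by
  have hcyc : d n y ∈ chainCycles d n := by
    cases n with
    | zero => trivial
    | succ n => exact hd n y
  obtain ⟨w, hw, hwy⟩ := isAcyclicAlong_of_isRadical p hd hI hexact hzero n _ hy hcyc
  obtain ⟨z, hz⟩ := hexact n (show y - w ∈ (d n).ker by
    rw [LinearMap.mem_ker, map_sub, hwy, sub_self])
  exact ⟨z, by rwa [hz, sub_sub_cancel]⟩

end Complexes

section Tor

variable {A : Type u} [CommRing A]

/-- For `X` a cyclic module `A ⧸ ker π`, the module `X ⊗ M` is the quotient `M ⧸ (ker π) M`. -/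
noncomputable def quotSMulEquivTensor {X M : Type*} [AddCommGroup X] [Module A X]
    [AddCommGroup M] [Module A M] (π : A →ₗ[A] X) (hπ : Function.Surjective π) :
    (M ⧸ (π.ker • (⊤ : Submodule A M))) ≃ₗ[A] X ⊗[A] M :=
  (TensorProduct.quotTensorEquivQuotSMul M π.ker).symm ≪≫ₗ
    (π.quotKerEquivOfSurjective hπ).rTensor M

lemma quotSMulEquivTensor_mk {X M : Type*} [AddCommGroup X] [Module A X]
    [AddCommGroup M] [Module A M] (π : A →ₗ[A] X) (hπ : Function.Surjective π) (y : M) :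
    quotSMulEquivTensor π hπ (Submodule.Quotient.mk y) = π 1 ⊗ₜ y :=
  rfl

lemma exists_tmul_eq {X M : Type*} [AddCommGroup X] [Module A X] [AddCommGroup M] [Module A M]
    (π : A →ₗ[A] X) (hπ : Function.Surjective π) (t : X ⊗[A] M) : ∃ y : M, π 1 ⊗ₜ y = t := by
  obtain ⟨q, rfl⟩ := (quotSMulEquivTensor π hπ).surjective t
  obtain ⟨y, rfl⟩ := Submodule.Quotient.mk_surjective _ q
  exact ⟨y, rfl⟩

lemma tmul_eq_zero_iff {X M : Type*} [AddCommGroup X] [Module A X] [AddCommGroup M] [Module A M]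
    (π : A →ₗ[A] X) (hπ : Function.Surjective π) (y : M) :
    π 1 ⊗ₜ[A] y = 0 ↔ y ∈ π.ker • (⊤ : Submodule A M) := by
  rw [← quotSMulEquivTensor_mk π hπ, LinearEquiv.map_eq_zero_iff, Submodule.Quotient.mk_eq_zero]

/-- Quotients of perfect rings by radical ideals are Tor-unital: `Tor_n^A(A ⧸ I, Y) = 0` for
`n ≥ 1` and every `A ⧸ I`-module `Y`. -/
lemma isZero_tor_succ_of_isRadical (p : ℕ) [Fact p.Prime] [CharP A p] [PerfectRing A p]
    {X Y : Type u} [AddCommGroup X] [Module A X] [AddCommGroup Y] [Module A Y]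
    (π : A →ₗ[A] X) (hπ : Function.Surjective π) (hrad : Ideal.IsRadical π.ker)
    (hY : ∀ a ∈ π.ker, ∀ y : Y, a • y = 0) (n : ℕ) :
    IsZero (((Tor (ModuleCat.{u} A) (n + 1)).obj (ModuleCat.of A X)).obj (ModuleCat.of A Y)) := by
  let R := ProjectiveResolution.of (ModuleCat.of A Y)
  let F := (MonoidalCategory.tensoringLeft (ModuleCat.{u} A)).obj (ModuleCat.of A X)
  let d (n : ℕ) : R.complex.X (n + 1) →ₗ[A] R.complex.X n := (R.complex.d (n + 1) n).hom
  have (n : ℕ) : Module.Projective A (R.complex.X n) :=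
    (IsProjective.iff_projective _).2 (R.projective n)
  have hd (n : ℕ) (x) : d n (d (n + 1) x) = 0 :=
    LinearMap.congr_fun (congrArg ModuleCat.Hom.hom (R.complex.d_comp_d (n + 2) (n + 1) n)) x
  have hexact (n : ℕ) : (d n).ker ≤ (d (n + 1)).range :=
    (ShortComplex.moduleCat_exact_iff_ker_sub_range _).1 (R.exact_succ n)
  have hzero : π.ker • (⊤ : Submodule A (R.complex.X 0)) ≤ (d 0).range := by
    refine le_trans ?_ ((ShortComplex.moduleCat_exact_iff_ker_sub_range _).1 R.exact₀)
    refine Submodule.smul_le.2 fun a ha y _ => LinearMap.mem_ker.2 ?_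
    let e := (HomologicalComplex.singleObjXSelf (ComplexShape.down ℕ) 0
      (ModuleCat.of A Y)).toLinearEquiv
    apply e.injective
    rw [map_smul, map_smul, map_zero]
    exact hY a ha _
  refine IsZero.of_iso ?_ (R.isoLeftDerivedObj F (n + 1))
  refine (HomologicalComplex.exactAt_iff_isZero_homology _ _).1 ?_
  refine (HomologicalComplex.exactAt_iff' _ (n + 2) (n + 1) n (by simp) (by simp)).2 ?_
  rw [ShortComplex.moduleCat_exact_iff]
  intro (x : X ⊗[A] R.complex.X (n + 1)) (hx : (d n).lTensor X x = 0)
  obtain ⟨y, rfl⟩ := exists_tmul_eq π hπ x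
  rw [LinearMap.lTensor_tmul, tmul_eq_zero_iff π hπ] at hx
  obtain ⟨z, hz⟩ := exists_sub_mem_smul_top (P := fun n => R.complex.X n) (d := d) p hd hrad
    hexact hzero n y hx
  refine ⟨(π 1 ⊗ₜ z : X ⊗[A] R.complex.X (n + 2)), ?_⟩
  rw [← tmul_eq_zero_iff π hπ, TensorProduct.tmul_sub, sub_eq_zero] at hz
  exact hz.symm

end Tor

lemma perfectRing_tensorProduct (p : ℕ) [Fact p.Prime] (R S : Type*) [CommRing R] [CommRing S]
    [Algebra (ZMod p) R] [Algebra (ZMod p) S] [ExpChar R p] [ExpChar S p] [PerfectRing R p]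
    [PerfectRing S p] [ExpChar (R ⊗[ZMod p] S) p] : PerfectRing (R ⊗[ZMod p] S) p := by
  let e := Algebra.TensorProduct.congr (FiniteField.frobeniusAlgEquiv (ZMod p) R p)
    (FiniteField.frobeniusAlgEquiv (ZMod p) S p)
  have he : (e : R ⊗[ZMod p] S →ₐ[ZMod p] R ⊗[ZMod p] S) =
      FiniteField.frobeniusAlgHom (ZMod p) _ := by
    ext <;> simp [e]
  refine ⟨?_⟩
  convert e.bijective using 1
  ext x
  simpa using (AlgHom.congr_fun he x).symm

section

variable (p : ℕ) [Fact p.Prime] (k : Type u) [Field k] [Algebra (ZMod p) k]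

/-- The enveloping algebra `A = k ⊗_{F_p} k` of `k` over its prime field. -/
abbrev EnvAlg : Type u := k ⊗[ZMod p] k

/-- `k`, regarded as a module over `A = k ⊗_{F_p} k` through the multiplication map
`A → k`, `λ ⊗ μ ↦ λμ`. -/
noncomputable local instance : Module (EnvAlg p k) k :=
  Module.compHom k (Algebra.TensorProduct.lmul' (ZMod p) (S := k)).toRingHom

/-- **Djament–Touzé (Hochschild homology of a perfect field).**
If `k` is a perfect field of characteristic `p > 0` and `A = k ⊗_{F_p} k`, with `k` an
`A`-module via `λ ⊗ μ ↦ λμ`, then `Tor_n^A(k, k) = 0` (i.e. it is a zero object of the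
category of `A`-modules) for all `n ≥ 1`. -/
theorem tor_enveloping_algebra_vanishes
    [CharP k p] [PerfectField k] (n : ℕ) (hn : 1 ≤ n) :
    IsZero (((Tor (ModuleCat.{u} (EnvAlg p k)) n).obj
        (ModuleCat.of (EnvAlg p k) k)).obj (ModuleCat.of (EnvAlg p k) k)) := by
  obtain ⟨n, rfl⟩ := Nat.exists_eq_add_of_le' hn
  have : CharP (EnvAlg p k) p := charP_of_injective_algebraMap' (ZMod p) p
  have : PerfectRing (EnvAlg p k) p := perfectRing_tensorProduct p k k
  let m := Algebra.TensorProduct.lmul' (ZMod p) (S := k)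
  let π : EnvAlg p k →ₗ[EnvAlg p k] k := LinearMap.toSpanSingleton _ _ 1
  have hπ (a : EnvAlg p k) : π a = m a := mul_one (m a)
  refine isZero_tor_succ_of_isRadical p π
    (fun x => ⟨x ⊗ₜ 1, by simp [hπ, m]⟩) (fun a ⟨r, hr⟩ => ?_) (fun a ha y => ?_) n
  · rw [LinearMap.mem_ker, hπ, map_pow] at hr
    rw [LinearMap.mem_ker, hπ, eq_zero_of_pow_eq_zero hr]
  · rw [LinearMap.mem_ker, hπ] at ha
    exact (congrArg (· * y) ha).trans (zero_mul y)

end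

end DjamentTouze
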